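/- Under the two-group random mixture model, fix α,β∈[0,1]. If a sequence of decision rules δ^n satisfies P(FDP(δ^n) ≤ α) → 1 and P(FNP(δ^n) ≤ β) → 1 as n→∞, then β ≥ mFNR*(α). -/

import Mathlib

open MeasureTheory ProbabilityTheory Filter

namespace TwoGroup

/-- The two-group random mixture model: a σ-finite base measure on the sample space `𝒳`,
a null proportion `π0 ∈ (0,1)`, and null/non-null probability density functions `f0`, `f1`
with respect to the base measure. -/
structure Model (𝒳 : Type*) [MeasurableSpace 𝒳] where
  base : Measure 𝒳
  sigmaFinite : SigmaFinite base
  π0 : ℝ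
  π0_mem : π0 ∈ Set.Ioo (0 : ℝ) 1
  f0 : 𝒳 → ℝ
  f1 : 𝒳 → ℝ
  f0_meas : Measurable f0
  f1_meas : Measurable f1
  f0_nonneg : ∀ x, 0 ≤ f0 x
  f1_nonneg : ∀ x, 0 ≤ f1 x
  f0_prob : IsProbabilityMeasure (base.withDensity fun x => ENNReal.ofReal (f0 x))
  f1_prob : IsProbabilityMeasure (base.withDensity fun x => ENNReal.ofReal (f1 x))

namespace Model

variable {𝒳 : Type*} [MeasurableSpace 𝒳] (M : Model 𝒳)

/-- The non-null proportion `π1 = 1 - π0`. -/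
noncomputable def π1 : ℝ := 1 - M.π0

/-- The marginal density `f = π0 f0 + π1 f1`. -/
noncomputable def f (x : 𝒳) : ℝ := M.π0 * M.f0 x + M.π1 * M.f1 x

/-- The local false discovery rate `Lfdr(x) = π0 f0(x) / f(x)`. -/
noncomputable def Lfdr (x : 𝒳) : ℝ := M.π0 * M.f0 x / M.f x

/-- The joint law of a single pair `(θ, X)`; `true` encodes `θ = 1` (non-null). -/
noncomputable def joint : Measure (Bool × 𝒳) :=
  (ENNReal.ofReal M.π0) •
      ((Measure.dirac false).prod (M.base.withDensity fun x => ENNReal.ofReal (M.f0 x))) +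
    (ENNReal.ofReal M.π1) •
      ((Measure.dirac true).prod (M.base.withDensity fun x => ENNReal.ofReal (M.f1 x)))

/-- The joint law of `((θ1, X1), …, (θn, Xn))`: i.i.d. copies of `(θ, X)`. -/
noncomputable def jointN (n : ℕ) : Measure (Fin n → Bool × 𝒳) :=
  Measure.pi fun _ => M.joint

end Model

/-- Number of rejections `Σ_i δ_i`. -/
def nRej {n : ℕ} (d : Fin n → Bool) : ℝ := ∑ i, if d i then (1 : ℝ) else 0

/-- Number of false discoveries `Σ_i δ_i (1 - θ_i)`. -/
def nFD {n : ℕ} (θ d : Fin n → Bool) : ℝ :=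
  ∑ i, (if d i then (1 : ℝ) else 0) * (if θ i then (0 : ℝ) else 1)

/-- Number of acceptances `Σ_i (1 - δ_i)`. -/
def nAcc {n : ℕ} (d : Fin n → Bool) : ℝ := ∑ i, if d i then (0 : ℝ) else 1

/-- Number of false non-discoveries `Σ_i (1 - δ_i) θ_i`. -/
def nFN {n : ℕ} (θ d : Fin n → Bool) : ℝ :=
  ∑ i, (if d i then (0 : ℝ) else 1) * (if θ i then (1 : ℝ) else 0)

/-- False discovery proportion. -/
noncomputable def FDP {n : ℕ} (θ d : Fin n → Bool) : ℝ := nFD θ d / max 1 (nRej d)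

/-- False non-discovery proportion. -/
noncomputable def FNP {n : ℕ} (θ d : Fin n → Bool) : ℝ := nFN θ d / max 1 (nAcc d)

/-- A decision rule is a Markov kernel from `𝒳^n` to `{0,1}^n`: a measurable family of
probability measures on `Fin n → Bool`. -/
def IsRule {𝒳 : Type*} [MeasurableSpace 𝒳] {n : ℕ}
    (κ : (Fin n → 𝒳) → Measure (Fin n → Bool)) : Prop :=
  Measurable κ ∧ ∀ x, IsProbabilityMeasure (κ x)

namespace Model

variable {𝒳 : Type*} [MeasurableSpace 𝒳] (M : Model 𝒳)

/-- The false discovery rate `FDR = E[FDP]` of a (randomized) decision rule. -/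
noncomputable def FDR (n : ℕ) (κ : (Fin n → 𝒳) → Measure (Fin n → Bool)) : ℝ :=
  ∫ ω, ∫ d, FDP (fun i => (ω i).1) d ∂(κ fun i => (ω i).2) ∂(M.jointN n)

/-- The false non-discovery rate `FNR = E[FNP]` of a (randomized) decision rule. -/
noncomputable def FNR (n : ℕ) (κ : (Fin n → 𝒳) → Measure (Fin n → Bool)) : ℝ :=
  ∫ ω, ∫ d, FNP (fun i => (ω i).1) d ∂(κ fun i => (ω i).2) ∂(M.jointN n)

/-- The marginal FDR `mFDR = E[Σ δi (1-θi)] / E[Σ δi]` (with `0/0 = 0`). -/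
noncomputable def mFDR (n : ℕ) (κ : (Fin n → 𝒳) → Measure (Fin n → Bool)) : ℝ :=
  (∫ ω, ∫ d, nFD (fun i => (ω i).1) d ∂(κ fun i => (ω i).2) ∂(M.jointN n)) /
    (∫ ω, ∫ d, nRej d ∂(κ fun i => (ω i).2) ∂(M.jointN n))

/-- The marginal FNR `mFNR = E[Σ (1-δi) θi] / E[Σ (1-δi)]` (with `0/0 = 0`). -/
noncomputable def mFNR (n : ℕ) (κ : (Fin n → 𝒳) → Measure (Fin n → Bool)) : ℝ :=
  (∫ ω, ∫ d, nFN (fun i => (ω i).1) d ∂(κ fun i => (ω i).2) ∂(M.jointN n)) /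
    (∫ ω, ∫ d, nAcc d ∂(κ fun i => (ω i).2) ∂(M.jointN n))

/-- `FNR*_n(α)`: the minimum FNR over decision rules controlling FDR at level `α`. -/
noncomputable def FNRstar (n : ℕ) (α : ℝ) : ℝ :=
  sInf {r | ∃ κ : (Fin n → 𝒳) → Measure (Fin n → Bool),
    IsRule κ ∧ M.FDR n κ ≤ α ∧ r = M.FNR n κ}

/-- The minimum mFNR over decision rules for `n` hypotheses controlling mFDR at level `α`. -/
noncomputable def mFNRstarN (n : ℕ) (α : ℝ) : ℝ :=
  sInf {r | ∃ κ : (Fin n → 𝒳) → Measure (Fin n → Bool),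
    IsRule κ ∧ M.mFDR n κ ≤ α ∧ r = M.mFNR n κ}

/-- `mFNR*(α)` (this quantity does not depend on the number of hypotheses; we take `n = 1`). -/
noncomputable def mFNRstar (α : ℝ) : ℝ := M.mFNRstarN 1 α

/-- The marginal law of a single observation `X ∼ f`. -/
noncomputable def Pmix : Measure 𝒳 := M.base.withDensity fun x => ENNReal.ofReal (M.f x)

/-- The law of `W = Lfdr(X)`, `X ∼ f`. -/
noncomputable def νW : Measure ℝ := M.Pmix.map M.Lfdr

/-- `G(t) = P(W ≤ t)`. -/
noncomputable def G (t : ℝ) : ℝ := (M.νW (Set.Iic t)).toReal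

/-- `Ḡ(t) = P(W < t)`. -/
noncomputable def Gbar (t : ℝ) : ℝ := (M.νW (Set.Iio t)).toReal

/-- The generalized inverse `G^{-1}(u) = inf{t : G(t) ≥ u}`. -/
noncomputable def Ginv (u : ℝ) : ℝ := sInf {t | u ≤ M.G t}

/-- `P(W = t)`. -/
noncomputable def atom (t : ℝ) : ℝ := (M.νW {t}).toReal

/-- The randomization probability `p(u)`, satisfying
`Ḡ(G^{-1}(u)) + p(u) P(W = G^{-1}(u)) = u`. -/
noncomputable def pu (u : ℝ) : ℝ := (u - M.Gbar (M.Ginv u)) / M.atom (M.Ginv u)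

/-- `a(u) = E[W | S_u = 1]` for `u ∈ (0,1]`, `a(0) = 0`, where `S_u` is the Bernoulli(u)
thresholding variable of `W` at `G^{-1}(u)` with randomization `p(u)` at the boundary. -/
noncomputable def a (u : ℝ) : ℝ :=
  if u = 0 then 0
  else ((∫ w in Set.Iio (M.Ginv u), w ∂M.νW) + M.pu u * (M.Ginv u * M.atom (M.Ginv u))) / u

/-- `b(u) = E[1 - W | S_u = 0]` for `u ∈ [0,1)`, `b(1) = 0`. -/
noncomputable def b (u : ℝ) : ℝ :=
  if u = 1 then 0
  else ((∫ w in Set.Ioi (M.Ginv u), (1 - w) ∂M.νW)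
      + (1 - M.pu u) * ((1 - M.Ginv u) * M.atom (M.Ginv u))) / (1 - u)

/-- `b*(α) = inf{b(u) : u ∈ [0,1], a(u) ≤ α}`. -/
noncomputable def bstar (α : ℝ) : ℝ :=
  sInf {y | ∃ u ∈ Set.Icc (0 : ℝ) 1, M.a u ≤ α ∧ y = M.b u}

/-- `u*(α) = sup{u ∈ [0,1] : a(u) ≤ α}`. -/
noncomputable def ustar (α : ℝ) : ℝ :=
  sSup {u | u ∈ Set.Icc (0 : ℝ) 1 ∧ M.a u ≤ α}

/-- `b**(α) = inf{E[b(U)] : U a [0,1]-valued random variable with E[a(U)] ≤ α}`. -/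
noncomputable def bstarstar (α : ℝ) : ℝ :=
  sInf {y | ∃ ρ : Measure ℝ, IsProbabilityMeasure ρ ∧ (∀ᵐ u ∂ρ, u ∈ Set.Icc (0 : ℝ) 1) ∧
    (∫ u, M.a u ∂ρ) ≤ α ∧ y = ∫ u, M.b u ∂ρ}

end Model

/-- The Bernoulli(p) measure on `Bool`. -/
noncomputable def bern (p : ℝ) : Measure Bool :=
  (ENNReal.ofReal p) • Measure.dirac true + (ENNReal.ofReal (1 - p)) • Measure.dirac false

namespace Model

variable {𝒳 : Type*} [MeasurableSpace 𝒳] (M : Model 𝒳)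

/-- The per-observation rejection probability of the Neyman–Pearson rule at level `α`:
reject if `Lfdr(x) < G^{-1}(u*(α))`, randomize with probability `p(u*(α))` at equality,
and accept otherwise. -/
noncomputable def qNP (α : ℝ) (x : 𝒳) : ℝ :=
  if M.Lfdr x < M.Ginv (M.ustar α) then 1
  else if M.Lfdr x = M.Ginv (M.ustar α) then M.pu (M.ustar α)
  else 0

/-- The Neyman–Pearson rule `δ^n_NP(α)`, as a Markov kernel: independent randomized
likelihood-ratio tests applied to each observation. -/
noncomputable def NP (α : ℝ) (n : ℕ) : (Fin n → 𝒳) → Measure (Fin n → Bool) :=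
  fun x => Measure.pi fun i => bern (M.qNP α (x i))

/-- The probability (over data and the randomization of the rule `κ`) that the decision vector
lies in the set `E θ` (which may depend on the true labels `θ`). -/
noncomputable def prob (n : ℕ) (κ : (Fin n → 𝒳) → Measure (Fin n → Bool))
    (E : (Fin n → Bool) → Set (Fin n → Bool)) : ℝ :=
  (∫⁻ ω, κ (fun i => (ω i).2) (E fun i => (ω i).1) ∂(M.jointN n)).toReal

end Model

/-- `sortedVal n w i` is the `i`-th order statistic `w_(i)` (for `1 ≤ i ≤ n`) of
`w 0, …, w (n-1)`. -/
noncomputable def sortedVal (n : ℕ) (w : Fin n → ℝ) (i : ℕ) : ℝ :=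
  ((Multiset.map w Finset.univ.val).sort (· ≤ ·)).getD (i - 1) 0

/-- `avgLow n w k = (1/k) Σ_{i=1}^k w_(i)` (equal to `0` when `k = 0`). -/
noncomputable def avgLow (n : ℕ) (w : Fin n → ℝ) (k : ℕ) : ℝ :=
  (∑ i ∈ Finset.Icc 1 k, sortedVal n w i) / k

/-- `avgHigh n w k = (1/(n-k)) Σ_{i=k+1}^n (1 - w_(i))` (equal to `0` when `k = n`). -/
noncomputable def avgHigh (n : ℕ) (w : Fin n → ℝ) (k : ℕ) : ℝ :=
  (∑ i ∈ Finset.Icc (k + 1) n, (1 - sortedVal n w i)) / ((n : ℝ) - k)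

/-- The greatest convex minorant on `[0,1]` of a function `h`, evaluated at `α`. -/
noncomputable def gcm (h : ℝ → ℝ) (α : ℝ) : ℝ :=
  sSup {y | ∃ C : ℝ → ℝ, ConvexOn ℝ (Set.Icc 0 1) C ∧
    (∀ t ∈ Set.Icc (0 : ℝ) 1, C t ≤ h t) ∧ y = C α}

end TwoGroup

namespace TwoGroup

theorem exists_weak_limit {α : Type*} [MeasurableSpace α] {μ : Measure α}
    [IsFiniteMeasure μ] {q : ℕ → α → ℝ} (hq : ∀ n, Measurable (q n))
    (hq01 : ∀ n x, q n x ∈ Set.Icc (0 : ℝ) 1) :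
    ∃ q' : α → ℝ, Measurable q' ∧ (∀ x, q' x ∈ Set.Icc (0 : ℝ) 1) ∧
      ∀ g : α → ℝ, MemLp g 2 μ →
        Tendsto (fun n => ∫ x, q n x * g x ∂μ) (hyperfilter ℕ) (nhds (∫ x, q' x * g x ∂μ)) := by
  have hbound : ∀ n, ∀ᵐ x ∂μ, ‖q n x‖ ≤ 1 := fun n => ae_of_all _ fun x => by
    rw [Real.norm_of_nonneg (hq01 n x).1]; exact (hq01 n x).2
  have hmem : ∀ n, MemLp (q n) 2 μ := fun n =>
    MemLp.of_bound (hq n).aestronglyMeasurable 1 (hbound n)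
  let v : ℕ → Lp ℝ 2 μ := fun n => (hmem n).toLp (q n)
  let C : ℝ := μ.real Set.univ ^ (2 : ENNReal).toReal⁻¹ * 1
  have hv : ∀ n, ‖v n‖ ≤ C := fun n => Lp.norm_le_of_ae_bound zero_le_one (by
    filter_upwards [(hmem n).coeFn_toLp, hbound n] with x hx hx'
    rwa [hx])
  let φ : ℕ → WeakDual ℝ (Lp ℝ 2 μ) := fun n =>
    WeakDual.toStrongDual.symm (InnerProductSpace.toDual ℝ _ (v n))
  obtain ⟨ψ, -, hψ⟩ := (WeakDual.isCompact_closedBall (𝕜 := ℝ) (E := Lp ℝ 2 μ) 0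
    C).ultrafilter_le_nhds ((hyperfilter ℕ).map φ) (by
      rw [le_principal_iff]
      refine Filter.mem_map.2 (Filter.univ_mem' fun n => ?_)
      simpa [φ] using hv n)
  have hψ : Tendsto φ (hyperfilter ℕ) (nhds ψ) := hψ
  let w : Lp ℝ 2 μ := (InnerProductSpace.toDual ℝ _).symm (WeakDual.toStrongDual ψ)
  have hlim : ∀ g : α → ℝ, MemLp g 2 μ →
      Tendsto (fun n => ∫ x, q n x * g x ∂μ) (hyperfilter ℕ) (nhds (∫ x, w x * g x ∂μ)) := by
    intro g hg
    have h1 := ((WeakDual.eval_continuous (hg.toLp g)).tendsto ψ).comp hψ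
    have h2 : ψ (hg.toLp g) = ∫ x, w x * g x ∂μ := by
      have : ψ (hg.toLp g) = inner ℝ w (hg.toLp g) := by
        simp only [w, InnerProductSpace.toDual_symm_apply]; rfl
      rw [this, L2.inner_def]
      refine integral_congr_ae ?_
      filter_upwards [hg.coeFn_toLp] with x hx
      simp [hx, mul_comm]
    have h3 : ∀ n, φ n (hg.toLp g) = ∫ x, q n x * g x ∂μ := by
      intro n
      have : φ n (hg.toLp g) = inner ℝ (v n) (hg.toLp g) := rfl
      rw [this, L2.inner_def]
      refine integral_congr_ae ?_
      filter_upwards [hg.coeFn_toLp, (hmem n).coeFn_toLp] with x hx hx'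
      simp [hx, v, hx', mul_comm]
    simpa [Function.comp_def, h2, h3] using h1
  have hw : Integrable w μ := (Lp.memLp w).integrable (by norm_num)
  have hlim_set : ∀ s, MeasurableSet s →
      Tendsto (fun n => ∫ x in s, q n x ∂μ) (hyperfilter ℕ) (nhds (∫ x in s, w x ∂μ)) := by
    intro s hs
    have := hlim (s.indicator 1) (memLp_indicator_const 2 hs (1 : ℝ) (Or.inr (measure_ne_top _ _)))
    have key : ∀ h : α → ℝ, ∫ x, h x * s.indicator 1 x ∂μ = ∫ x in s, h x ∂μ := by
      intro h
      rw [← integral_indicator hs]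
      refine integral_congr_ae (ae_of_all _ fun x => ?_)
      by_cases hx : x ∈ s <;> simp [hx]
    simpa only [key] using this
  have hw0 : 0 ≤ᵐ[μ] w := ae_nonneg_of_forall_setIntegral_nonneg hw fun s hs _ =>
    ge_of_tendsto' (hlim_set s hs) fun n => integral_nonneg fun x => (hq01 n x).1
  have hw1 : w ≤ᵐ[μ] fun _ => (1 : ℝ) := ae_le_of_forall_setIntegral_le hw (integrable_const _)
    fun s hs _ => le_of_tendsto' (hlim_set s hs) fun n =>
      integral_mono ((hmem n).integrable (by norm_num)).integrableOn (integrable_const _)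
        fun x => (hq01 n x).2
  refine ⟨fun x => max 0 (min 1 (w x)),
    measurable_const.max (measurable_const.min (Lp.stronglyMeasurable w).measurable),
    fun x => ⟨le_max_left _ _, max_le zero_le_one (min_le_left _ _)⟩, fun g hg => ?_⟩
  convert hlim g hg using 2
  refine integral_congr_ae ?_
  filter_upwards [hw0, hw1] with x h0 h1
  have h0 : 0 ≤ w x := h0
  simp only [min_eq_right h1, max_eq_right h0]

theorem exists_density_restrict_map {Ω 𝒳 : Type*} [MeasurableSpace Ω] [MeasurableSpace 𝒳]
    (Q : Measure Ω) [IsFiniteMeasure Q] {X : Ω → 𝒳} (hX : Measurable X) (D : Set Ω) :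
    ∃ q : 𝒳 → ℝ, Measurable q ∧ (∀ x, q x ∈ Set.Icc (0 : ℝ) 1) ∧
      ∀ g : 𝒳 → ℝ, Measurable g → ∫ ω in D, g (X ω) ∂Q = ∫ x, q x * g x ∂(Q.map X) := by
  let ρ := (Q.restrict D).map X
  have hρ : ρ ≤ Q.map X := Measure.map_mono Measure.restrict_le_self hX
  have hac : ρ ≪ Q.map X := Measure.absolutelyContinuous_of_le hρ
  refine ⟨fun x => min 1 (ρ.rnDeriv (Q.map X) x).toReal,
    measurable_const.min (Measure.measurable_rnDeriv _ _).ennreal_toReal,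
    fun x => ⟨le_min zero_le_one ENNReal.toReal_nonneg, min_le_left _ _⟩, fun g hg => ?_⟩
  rw [← integral_map (μ := Q.restrict D) hX.aemeasurable hg.aestronglyMeasurable,
    ← integral_rnDeriv_smul hac]
  refine integral_congr_ae ?_
  filter_upwards [Measure.rnDeriv_le_one_of_le hρ] with x hx
  have : (ρ.rnDeriv (Q.map X) x).toReal ≤ 1 :=
    ENNReal.toReal_le_of_le_ofReal zero_le_one (by simpa using hx)
  simp only [min_eq_right this, smul_eq_mul, ρ]

namespace Model

variable {𝒳 : Type*} [MeasurableSpace 𝒳] (M : Model 𝒳)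

theorem π1_pos : 0 < M.π1 := sub_pos.2 M.π0_mem.2

theorem f_nonneg (x : 𝒳) : 0 ≤ M.f x :=
  add_nonneg (mul_nonneg M.π0_mem.1.le (M.f0_nonneg x)) (mul_nonneg M.π1_pos.le (M.f1_nonneg x))

theorem measurable_f : Measurable M.f :=
  (M.f0_meas.const_mul _).add (M.f1_meas.const_mul _)

theorem measurable_Lfdr : Measurable M.Lfdr :=
  (M.f0_meas.const_mul _).div M.measurable_f

theorem Lfdr_mem_Icc (x : 𝒳) : M.Lfdr x ∈ Set.Icc (0 : ℝ) 1 := by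
  refine ⟨div_nonneg (mul_nonneg M.π0_mem.1.le (M.f0_nonneg x)) (M.f_nonneg x),
    div_le_one_of_le₀ ?_ (M.f_nonneg x)⟩
  exact le_add_of_nonneg_right (mul_nonneg M.π1_pos.le (M.f1_nonneg x))

theorem f_mul_Lfdr (x : 𝒳) : M.f x * M.Lfdr x = M.π0 * M.f0 x := by
  have h0 := mul_nonneg M.π0_mem.1.le (M.f0_nonneg x)
  have h1 := mul_nonneg M.π1_pos.le (M.f1_nonneg x)
  rcases eq_or_ne (M.f x) 0 with h | h
  · have h' : M.π0 * M.f0 x + M.π1 * M.f1 x = 0 := h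
    rw [h, zero_mul]; linarith
  · exact mul_div_cancel₀ _ h

theorem f_mul_one_sub_Lfdr (x : 𝒳) : M.f x * (1 - M.Lfdr x) = M.π1 * M.f1 x := by
  rw [mul_sub, f_mul_Lfdr, f]; ring

theorem lintegral_joint {F : Bool × 𝒳 → ENNReal} (hF : Measurable F) :
    ∫⁻ z, F z ∂M.joint = ∫⁻ x, (ENNReal.ofReal (M.Lfdr x) * F (false, x) +
      ENNReal.ofReal (1 - M.Lfdr x) * F (true, x)) ∂M.Pmix := by
  have := M.f0_prob
  have := M.f1_prob
  have hFb : ∀ b, Measurable fun x => F (b, x) := fun b => hF.comp measurable_prodMk_left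
  have hW := M.measurable_Lfdr
  have key : ∀ (c : ℝ) (_ : 0 ≤ c) (h : 𝒳 → ℝ) (_ : Measurable h) (b : Bool),
      ENNReal.ofReal c * ∫⁻ x, F (b, x) ∂(M.base.withDensity fun x => ENNReal.ofReal (h x)) =
        ∫⁻ x, ENNReal.ofReal (c * h x) * F (b, x) ∂M.base := by
    intro c hc h hh b
    rw [lintegral_withDensity_eq_lintegral_mul _ hh.ennreal_ofReal (hFb b),
      ← lintegral_const_mul _ (hh.ennreal_ofReal.mul (hFb b))]
    simp only [Pi.mul_apply, ENNReal.ofReal_mul hc, mul_assoc]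
  have hm : Measurable fun x => ENNReal.ofReal (M.π0 * M.f0 x) * F (false, x) :=
    (M.f0_meas.const_mul _).ennreal_ofReal.mul (hFb _)
  have hm' : Measurable fun x => ENNReal.ofReal (M.Lfdr x) * F (false, x) +
      ENNReal.ofReal (1 - M.Lfdr x) * F (true, x) :=
    (hW.ennreal_ofReal.mul (hFb _)).add ((hW.const_sub 1).ennreal_ofReal.mul (hFb _))
  rw [joint, lintegral_add_measure, lintegral_smul_measure, lintegral_smul_measure,
    Measure.dirac_prod, Measure.dirac_prod, lintegral_map hF measurable_prodMk_left,
    lintegral_map hF measurable_prodMk_left, smul_eq_mul, smul_eq_mul,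
    key _ M.π0_mem.1.le _ M.f0_meas, key _ M.π1_pos.le _ M.f1_meas,
    ← lintegral_add_left hm, Pmix,
    lintegral_withDensity_eq_lintegral_mul _ M.measurable_f.ennreal_ofReal hm']
  refine lintegral_congr fun x => ?_
  rw [← f_mul_Lfdr, ← f_mul_one_sub_Lfdr, ENNReal.ofReal_mul (M.f_nonneg x),
    ENNReal.ofReal_mul (M.f_nonneg x)]
  simp only [Pi.mul_apply]
  ring

instance : IsProbabilityMeasure M.joint := by
  have := M.f0_prob
  have := M.f1_prob
  constructor
  rw [joint]
  simp only [Measure.add_apply, Measure.smul_apply, measure_univ, smul_eq_mul, mul_one]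
  rw [← ENNReal.ofReal_add M.π0_mem.1.le M.π1_pos.le, π1]
  simp

theorem joint_map_snd : M.joint.map Prod.snd = M.Pmix := by
  ext s hs
  have h1 : Measurable (s.indicator (1 : 𝒳 → ENNReal)) := measurable_one.indicator hs
  have h2 : Measurable fun z : Bool × 𝒳 => s.indicator (1 : 𝒳 → ENNReal) z.2 :=
    h1.comp measurable_snd
  rw [← lintegral_indicator_one hs, lintegral_map h1 measurable_snd, lintegral_joint _ h2,
    ← lintegral_indicator_one hs]
  refine lintegral_congr fun x => ?_
  rw [← add_mul, ← ENNReal.ofReal_add (M.Lfdr_mem_Icc x).1 (sub_nonneg.2 (M.Lfdr_mem_Icc x).2)]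
  simp

instance : IsProbabilityMeasure M.Pmix := by
  rw [← joint_map_snd]
  exact Measure.isProbabilityMeasure_map measurable_snd.aemeasurable

instance (n : ℕ) : IsProbabilityMeasure (M.jointN n) := by
  unfold jointN; infer_instance

theorem lintegral_joint_null {p : 𝒳 → ENNReal} (hp : Measurable p) :
    ∫⁻ z, p z.2 * (if z.1 then 0 else 1) ∂M.joint =
      ∫⁻ z, p z.2 * ENNReal.ofReal (M.Lfdr z.2) ∂M.joint := by
  have hW := M.measurable_Lfdr
  have h1 : Measurable fun z : Bool × 𝒳 => (if z.1 then (0 : ENNReal) else 1) :=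
    (Measurable.of_discrete (f := fun b : Bool => if b then (0 : ENNReal) else 1)).comp
      measurable_fst
  have h2 : Measurable fun z : Bool × 𝒳 => p z.2 * (if z.1 then 0 else 1) :=
    (hp.comp measurable_snd).mul h1
  have h3 : Measurable fun z : Bool × 𝒳 => p z.2 * ENNReal.ofReal (M.Lfdr z.2) :=
    (hp.mul hW.ennreal_ofReal).comp measurable_snd
  rw [lintegral_joint _ h2, lintegral_joint _ h3]
  refine lintegral_congr fun x => ?_
  rw [← add_mul, ← ENNReal.ofReal_add (M.Lfdr_mem_Icc x).1 (sub_nonneg.2 (M.Lfdr_mem_Icc x).2)]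
  simp [mul_comm]

theorem lintegral_jointN_null {n : ℕ} (i : Fin n) {p : (Fin n → 𝒳) → ENNReal}
    (hp : Measurable p) :
    ∫⁻ ω, p (fun j => (ω j).2) * (if (ω i).1 then 0 else 1) ∂M.jointN n =
      ∫⁻ ω, p (fun j => (ω j).2) * ENNReal.ofReal (M.Lfdr (ω i).2) ∂M.jointN n := by
  have hX : Measurable fun (ω : Fin n → Bool × 𝒳) j => (ω j).2 := by fun_prop
  have h1 : Measurable fun ω : Fin n → Bool × 𝒳 => (if (ω i).1 then (0 : ENNReal) else 1) :=
    (Measurable.of_discrete (f := fun b : Bool => if b then (0 : ENNReal) else 1)).comp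
      (measurable_fst.comp (measurable_pi_apply i))
  have h2 : Measurable fun ω : Fin n → Bool × 𝒳 => ENNReal.ofReal (M.Lfdr (ω i).2) :=
    (M.measurable_Lfdr.comp (measurable_snd.comp (measurable_pi_apply i))).ennreal_ofReal
  have h3 : Measurable fun ω : Fin n → Bool × 𝒳 =>
      p (fun j => (ω j).2) * (if (ω i).1 then 0 else 1) := (hp.comp hX).mul h1
  have h4 : Measurable fun ω : Fin n → Bool × 𝒳 =>
      p (fun j => (ω j).2) * ENNReal.ofReal (M.Lfdr (ω i).2) := (hp.comp hX).mul h2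
  have : Nonempty (Bool × 𝒳) := nonempty_of_isProbabilityMeasure M.joint
  let ω₀ : Fin n → Bool × 𝒳 := fun _ => Classical.arbitrary _
  rw [jointN, lintegral_eq_lmarginal_univ ω₀, lintegral_eq_lmarginal_univ ω₀,
    lmarginal_erase' _ h3 (Finset.mem_univ i), lmarginal_erase' _ h4 (Finset.mem_univ i)]
  congr 1
  funext ω
  have hu : ∀ z : Bool × 𝒳, (fun j => (Function.update ω i z j).2) =
      Function.update (fun j => (ω j).2) i z.2 := by
    intro z
    funext j
    rcases eq_or_ne j i with rfl | h
    · simp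
    · simp [h]
  simp only [hu, Function.update_self]
  exact M.lintegral_joint_null (hp.comp (measurable_update _))

/-- The kernel drawing a decision vector from the rule `κ`, given labels and observations. -/
noncomputable def ruleKernel {n : ℕ} {κ : (Fin n → 𝒳) → Measure (Fin n → Bool)} (h : IsRule κ) :
    Kernel (Fin n → Bool × 𝒳) (Fin n → Bool) :=
  ⟨fun ω => κ fun i => (ω i).2, h.1.comp (by fun_prop)⟩

instance {n : ℕ} {κ : (Fin n → 𝒳) → Measure (Fin n → Bool)} (h : IsRule κ) :
    IsMarkovKernel (ruleKernel h) :=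
  ⟨fun _ => h.2 _⟩

/-- The joint law of labels, observations and decisions under the rule `κ`. -/
noncomputable def ruleLaw {n : ℕ} {κ : (Fin n → 𝒳) → Measure (Fin n → Bool)} (h : IsRule κ) :
    Measure ((Fin n → Bool × 𝒳) × (Fin n → Bool)) :=
  M.jointN n ⊗ₘ ruleKernel h

instance {n : ℕ} {κ : (Fin n → 𝒳) → Measure (Fin n → Bool)} (h : IsRule κ) :
    IsProbabilityMeasure (M.ruleLaw h) := by
  unfold ruleLaw; infer_instance

theorem ruleLaw_map_obs {n : ℕ} {κ : (Fin n → 𝒳) → Measure (Fin n → Bool)} (h : IsRule κ)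
    (i : Fin n) : (M.ruleLaw h).map (fun p => (p.1 i).2) = M.Pmix := by
  have h1 : (M.ruleLaw h).map Prod.fst = M.jointN n := Measure.fst_compProd _ _
  have h2 : (M.jointN n).map (fun ω => ω i) = M.joint :=
    (measurePreserving_eval (fun _ : Fin n => M.joint) i).map_eq
  rw [← joint_map_snd, ← h2, ← h1, Measure.map_map (measurable_pi_apply i) measurable_fst,
    Measure.map_map measurable_snd ((measurable_pi_apply i).comp measurable_fst)]
  rfl

theorem setIntegral_ruleLaw_null {n : ℕ} {κ : (Fin n → 𝒳) → Measure (Fin n → Bool)}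
    (h : IsRule κ) (i : Fin n) (T : Set (Fin n → Bool)) :
    ∫ p in Prod.snd ⁻¹' T, (if (p.1 i).1 then (0 : ℝ) else 1) ∂(M.ruleLaw h) =
      ∫ p in Prod.snd ⁻¹' T, M.Lfdr (p.1 i).2 ∂(M.ruleLaw h) := by
  have hT : MeasurableSet T := T.toFinite.measurableSet
  have hp : Measurable fun x => κ x T := (Measure.measurable_coe hT).comp h.1
  have key : ∀ g : (Fin n → Bool × 𝒳) → ℝ, Measurable g → (∀ ω, 0 ≤ g ω) →
      ∫ p in Prod.snd ⁻¹' T, g p.1 ∂(M.ruleLaw h) =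
        (∫⁻ ω, κ (fun j => (ω j).2) T * ENNReal.ofReal (g ω) ∂(M.jointN n)).toReal := by
    intro g hg hg0
    have hg1 : Measurable fun p : (Fin n → Bool × 𝒳) × (Fin n → Bool) => g p.1 :=
      hg.comp measurable_fst
    rw [integral_eq_lintegral_of_nonneg_ae
      (f := fun p : (Fin n → Bool × 𝒳) × (Fin n → Bool) => g p.1) (ae_of_all _ fun p => hg0 p.1)
      hg1.aestronglyMeasurable, ← lintegral_indicator (measurable_snd hT), ruleLaw,
      Measure.lintegral_compProd (hg1.ennreal_ofReal.indicator (measurable_snd hT))]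
    congr 1
    refine lintegral_congr fun ω => ?_
    have : (fun d => (Prod.snd ⁻¹' T).indicator
        (fun p : (Fin n → Bool × 𝒳) × (Fin n → Bool) => ENNReal.ofReal (g p.1)) (ω, d)) =
        T.indicator fun _ => ENNReal.ofReal (g ω) := by
      funext d
      by_cases hd : d ∈ T <;> simp [hd]
    rw [this, lintegral_indicator_const hT, mul_comm]
    rfl
  have hθ : Measurable fun ω : Fin n → Bool × 𝒳 => (if (ω i).1 then (0 : ℝ) else 1) :=
    (Measurable.of_discrete (f := fun b : Bool => if b then (0 : ℝ) else 1)).comp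
      (measurable_fst.comp (measurable_pi_apply i))
  have hW : Measurable fun ω : Fin n → Bool × 𝒳 => M.Lfdr (ω i).2 :=
    M.measurable_Lfdr.comp (measurable_snd.comp (measurable_pi_apply i))
  rw [key _ hθ fun ω => by split_ifs <;> norm_num, key _ hW fun ω => (M.Lfdr_mem_Icc _).1,
    ← M.lintegral_jointN_null i hp]
  congr 1
  refine lintegral_congr fun ω => ?_
  split_ifs <;> simp

theorem integrable_Pmix_mul {g k : 𝒳 → ℝ} (hg : Measurable g) (hk : Measurable k)
    (hg1 : ∀ x, g x ∈ Set.Icc (0 : ℝ) 1) (hk1 : ∀ x, k x ∈ Set.Icc (0 : ℝ) 1) :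
    Integrable (fun x => g x * k x) M.Pmix :=
  Integrable.of_bound (hg.mul hk).aestronglyMeasurable 1 (ae_of_all _ fun x => by
    rw [Real.norm_of_nonneg (mul_nonneg (hg1 x).1 (hk1 x).1)]
    exact mul_le_one₀ (hg1 x).2 (hk1 x).1 (hk1 x).2)

theorem exists_coordinate_rejection_probability {n : ℕ}
    {κ : (Fin n → 𝒳) → Measure (Fin n → Bool)} (h : IsRule κ) (i : Fin n) :
    ∃ q : 𝒳 → ℝ, Measurable q ∧ (∀ x, q x ∈ Set.Icc (0 : ℝ) 1) ∧
      ∫ p, (if p.2 i then (1 : ℝ) else 0) ∂(M.ruleLaw h) = ∫ x, q x ∂M.Pmix ∧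
      ∫ p, (if p.2 i then (1 : ℝ) else 0) * (if (p.1 i).1 then 0 else 1) ∂(M.ruleLaw h) =
        ∫ x, q x * M.Lfdr x ∂M.Pmix ∧
      ∫ p, (if (p.1 i).1 then (0 : ℝ) else 1) ∂(M.ruleLaw h) = ∫ x, M.Lfdr x ∂M.Pmix := by
  have hX : Measurable fun p : (Fin n → Bool × 𝒳) × (Fin n → Bool) => (p.1 i).2 :=
    measurable_snd.comp ((measurable_pi_apply i).comp measurable_fst)
  let T : Set (Fin n → Bool) := {d | d i = true}
  have hT : MeasurableSet T := T.toFinite.measurableSet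
  obtain ⟨q, hq, hq01, hint⟩ := exists_density_restrict_map (M.ruleLaw h) hX (Prod.snd ⁻¹' T)
  rw [ruleLaw_map_obs] at hint
  have hset : ∀ g : (Fin n → Bool × 𝒳) × (Fin n → Bool) → ℝ,
      ∫ p in Prod.snd ⁻¹' T, g p ∂(M.ruleLaw h) =
        ∫ p, (if p.2 i then (1 : ℝ) else 0) * g p ∂(M.ruleLaw h) := by
    intro g
    rw [← integral_indicator (measurable_snd hT)]
    refine integral_congr_ae (ae_of_all _ fun p => ?_)
    by_cases hp : p.2 i = true <;> simp [T, hp]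
  refine ⟨q, hq, hq01, ?_, ?_, ?_⟩
  · have := hint (fun _ => 1) measurable_const
    rw [hset] at this
    simpa using this
  · rw [← hset, setIntegral_ruleLaw_null, hint _ M.measurable_Lfdr]
  · have := M.setIntegral_ruleLaw_null h i Set.univ
    simp only [Set.preimage_univ, Measure.restrict_univ] at this
    rw [this, ← M.ruleLaw_map_obs h i,
      integral_map hX.aemeasurable M.measurable_Lfdr.aestronglyMeasurable]

theorem measurable_labels_decision {n : ℕ} :
    Measurable fun p : (Fin n → Bool × 𝒳) × (Fin n → Bool) => (fun i => (p.1 i).1, p.2) := by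
  fun_prop

theorem integrable_ruleLaw {n : ℕ} {κ : (Fin n → 𝒳) → Measure (Fin n → Bool)} (h : IsRule κ)
    (F : (Fin n → Bool) → (Fin n → Bool) → ℝ) :
    Integrable (fun p => F (fun i => (p.1 i).1) p.2) (M.ruleLaw h) := by
  have := Measure.isProbabilityMeasure_map (μ := M.ruleLaw h)
    measurable_labels_decision.aemeasurable
  exact (Integrable.of_finite (f := fun z : (Fin n → Bool) × (Fin n → Bool) => F z.1 z.2)
    (μ := (M.ruleLaw h).map fun p => (fun i => (p.1 i).1, p.2))).comp_measurable
      measurable_labels_decision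

theorem prob_eq_ruleLaw_real {n : ℕ} {κ : (Fin n → 𝒳) → Measure (Fin n → Bool)} (h : IsRule κ)
    (E : (Fin n → Bool) → Set (Fin n → Bool)) :
    M.prob n κ E = (M.ruleLaw h).real {p | p.2 ∈ E fun i => (p.1 i).1} := by
  have hE : MeasurableSet {p : (Fin n → Bool × 𝒳) × (Fin n → Bool) | p.2 ∈ E fun i => (p.1 i).1} :=
    measurable_labels_decision
      (Set.toFinite {z : (Fin n → Bool) × (Fin n → Bool) | z.2 ∈ E z.1}).measurableSet
  rw [measureReal_def, ruleLaw, Measure.compProd_apply hE]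
  rfl

theorem integral_ruleLaw_le_of_event {n : ℕ} {κ : (Fin n → 𝒳) → Measure (Fin n → Bool)}
    (h : IsRule κ) (F : (Fin n → Bool) → (Fin n → Bool) → ℝ)
    (E : (Fin n → Bool) → Set (Fin n → Bool)) (hFn : ∀ θ d, F θ d ≤ n)
    (hFE : ∀ θ, ∀ d ∈ E θ, F θ d ≤ 0) :
    ∫ p, F (fun i => (p.1 i).1) p.2 ∂(M.ruleLaw h) ≤ n * (1 - M.prob n κ E) := by
  have hE : MeasurableSet {p : (Fin n → Bool × 𝒳) × (Fin n → Bool) | p.2 ∈ E fun i => (p.1 i).1} :=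
    measurable_labels_decision
      (Set.toFinite {z : (Fin n → Bool) × (Fin n → Bool) | z.2 ∈ E z.1}).measurableSet
  rw [prob_eq_ruleLaw_real, ← probReal_compl_eq_one_sub hE, mul_comm, ← smul_eq_mul,
    ← integral_indicator_const _ hE.compl]
  refine integral_mono (M.integrable_ruleLaw h F) ((integrable_const _).indicator hE.compl) ?_
  intro p
  by_cases hp : p.2 ∈ E fun i => (p.1 i).1
  · simpa [hp] using hFE _ _ hp
  · simpa [hp] using hFn _ _

end Model

theorem nAcc_eq {n : ℕ} (d : Fin n → Bool) : nAcc d = n - nRej d := by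
  have : (n : ℝ) = ∑ _i : Fin n, (1 : ℝ) := by simp
  rw [nAcc, nRej, this, ← Finset.sum_sub_distrib]
  refine Finset.sum_congr rfl fun i _ => ?_
  split_ifs <;> norm_num

theorem nFN_eq {n : ℕ} (θ d : Fin n → Bool) :
    nFN θ d = n - nRej d - (∑ i, if θ i then (0 : ℝ) else 1) + nFD θ d := by
  have : (n : ℝ) = ∑ _i : Fin n, (1 : ℝ) := by simp
  rw [nFN, nRej, nFD, this, ← Finset.sum_sub_distrib, ← Finset.sum_sub_distrib,
    ← Finset.sum_add_distrib]
  refine Finset.sum_congr rfl fun i _ => ?_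
  split_ifs <;> norm_num

theorem nRej_nonneg {n : ℕ} (d : Fin n → Bool) : 0 ≤ nRej d :=
  Finset.sum_nonneg fun i _ => by split_ifs <;> norm_num

theorem nAcc_nonneg {n : ℕ} (d : Fin n → Bool) : 0 ≤ nAcc d :=
  Finset.sum_nonneg fun i _ => by split_ifs <;> norm_num

theorem nFN_nonneg {n : ℕ} (θ d : Fin n → Bool) : 0 ≤ nFN θ d :=
  Finset.sum_nonneg fun i _ => by split_ifs <;> norm_num

theorem nFD_le_nRej {n : ℕ} (θ d : Fin n → Bool) : nFD θ d ≤ nRej d :=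
  Finset.sum_le_sum fun i _ => by split_ifs <;> norm_num

theorem nFN_le_nAcc {n : ℕ} (θ d : Fin n → Bool) : nFN θ d ≤ nAcc d :=
  Finset.sum_le_sum fun i _ => by split_ifs <;> norm_num

theorem one_le_nRej {n : ℕ} {d : Fin n → Bool} (h : nRej d ≠ 0) : 1 ≤ nRej d := by
  obtain ⟨i, hi⟩ : ∃ i, d i = true := by
    by_contra! hd
    exact h (Finset.sum_eq_zero fun i _ => by simp [hd i])
  calc (1 : ℝ) = if d i then 1 else 0 := by simp [hi]
    _ ≤ nRej d := Finset.single_le_sum (f := fun i => if d i then (1 : ℝ) else 0)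
      (fun j _ => by split_ifs <;> norm_num) (Finset.mem_univ i)

theorem one_le_nAcc {n : ℕ} {d : Fin n → Bool} (h : nAcc d ≠ 0) : 1 ≤ nAcc d := by
  obtain ⟨i, hi⟩ : ∃ i, d i = false := by
    by_contra! hd
    exact h (Finset.sum_eq_zero fun i _ => by simp [hd i])
  calc (1 : ℝ) = if d i then 0 else 1 := by simp [hi]
    _ ≤ nAcc d := Finset.single_le_sum (f := fun i => if d i then (0 : ℝ) else 1)
      (fun j _ => by split_ifs <;> norm_num) (Finset.mem_univ i)

theorem nFD_le_of_FDP_le {n : ℕ} {θ d : Fin n → Bool} {α : ℝ} (h : FDP θ d ≤ α) :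
    nFD θ d ≤ α * nRej d := by
  by_cases hd : nRej d = 0
  · have := nFD_le_nRej θ d
    rw [hd] at this ⊢
    simpa using this
  · have h1 := one_le_nRej hd
    rwa [FDP, max_eq_right h1, div_le_iff₀ (by linarith)] at h

theorem nFN_le_of_FNP_le {n : ℕ} {θ d : Fin n → Bool} {β : ℝ} (h : FNP θ d ≤ β) :
    nFN θ d ≤ β * nAcc d := by
  by_cases hd : nAcc d = 0
  · have := nFN_le_nAcc θ d
    rw [hd] at this ⊢
    simpa using this
  · have h1 := one_le_nAcc hd
    rwa [FNP, max_eq_right h1, div_le_iff₀ (by linarith)] at h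

namespace Model

variable {𝒳 : Type*} [MeasurableSpace 𝒳] (M : Model 𝒳)

/-- Averaging the coordinatewise rejection probabilities of a rule yields a single-observation
rejection probability with the same marginal error rates. -/
theorem exists_average_rejection_probability {n : ℕ} (hn : n ≠ 0)
    {κ : (Fin n → 𝒳) → Measure (Fin n → Bool)} (h : IsRule κ) :
    ∃ q : 𝒳 → ℝ, Measurable q ∧ (∀ x, q x ∈ Set.Icc (0 : ℝ) 1) ∧
      ∫ p, nRej p.2 ∂(M.ruleLaw h) = n * ∫ x, q x ∂M.Pmix ∧
      ∫ p, nFD (fun i => (p.1 i).1) p.2 ∂(M.ruleLaw h) = n * ∫ x, q x * M.Lfdr x ∂M.Pmix ∧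
      ∫ p, (∑ i, if (p.1 i).1 then (0 : ℝ) else 1) ∂(M.ruleLaw h) =
        n * ∫ x, M.Lfdr x ∂M.Pmix := by
  choose q hq hq01 hrej hfd hnull using M.exists_coordinate_rejection_probability h
  have hn' : (0 : ℝ) < n := by exact_mod_cast Nat.pos_of_ne_zero hn
  have hW := M.measurable_Lfdr
  refine ⟨fun x => (∑ i, q i x) / n, (Finset.measurable_sum _ fun i _ => hq i).div_const _,
    fun x => ⟨div_nonneg (Finset.sum_nonneg fun i _ => (hq01 i x).1) hn'.le, ?_⟩, ?_, ?_, ?_⟩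
  · rw [div_le_one hn']
    calc ∑ i, q i x ≤ ∑ _i : Fin n, (1 : ℝ) := Finset.sum_le_sum fun i _ => (hq01 i x).2
      _ = n := by simp
  · have hint : ∀ i, Integrable (q i) M.Pmix := fun i => by
      simpa using M.integrable_Pmix_mul (k := fun _ => 1) (hq i) measurable_const (hq01 i)
        fun _ => ⟨zero_le_one, le_rfl⟩
    rw [integral_div, mul_div_cancel₀ _ hn'.ne', integral_finsetSum _ fun i _ => hint i]
    simp only [nRej]
    rw [integral_finsetSum _ fun i _ =>
      M.integrable_ruleLaw h fun _ d => if d i then (1 : ℝ) else 0]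
    exact Finset.sum_congr rfl fun i _ => hrej i
  · have hint : ∀ i, Integrable (fun x => q i x * M.Lfdr x) M.Pmix := fun i =>
      M.integrable_Pmix_mul (hq i) hW (hq01 i) M.Lfdr_mem_Icc
    simp only [div_mul_eq_mul_div, Finset.sum_mul]
    rw [integral_div, mul_div_cancel₀ _ hn'.ne', integral_finsetSum _ fun i _ => hint i]
    simp only [nFD]
    rw [integral_finsetSum _ fun i _ => M.integrable_ruleLaw h fun θ d =>
      (if d i then (1 : ℝ) else 0) * if θ i then 0 else 1]
    exact Finset.sum_congr rfl fun i _ => hfd i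
  · rw [integral_finsetSum _ fun i _ =>
      M.integrable_ruleLaw h fun θ _ => if θ i then (0 : ℝ) else 1]
    simp [hnull]

theorem integral_const_sub_sub_add {Ω : Type*} [MeasurableSpace Ω] {μ : Measure Ω}
    [IsProbabilityMeasure μ] (c : ℝ) {u v w : Ω → ℝ} (hu : Integrable u μ) (hv : Integrable v μ)
    (hw : Integrable w μ) :
    ∫ x, (c - u x - v x + w x) ∂μ = c - ∫ x, u x ∂μ - ∫ x, v x ∂μ + ∫ x, w x ∂μ := by
  have h1 : Integrable (fun x => c - u x) μ := (integrable_const c).sub hu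
  have h2 : Integrable (fun x => c - u x - v x) μ := h1.sub hv
  rw [integral_add h2 hw, integral_sub h1 hv, integral_sub (integrable_const c) hu]
  simp

theorem integral_one_sub_mul_one_sub_Lfdr {q : 𝒳 → ℝ} (hq : Measurable q)
    (hq01 : ∀ x, q x ∈ Set.Icc (0 : ℝ) 1) :
    ∫ x, (1 - q x) * (1 - M.Lfdr x) ∂M.Pmix =
      1 - ∫ x, q x ∂M.Pmix - ∫ x, M.Lfdr x ∂M.Pmix + ∫ x, q x * M.Lfdr x ∂M.Pmix := by
  have h1 : ∀ x : 𝒳, (fun _ => (1 : ℝ)) x ∈ Set.Icc (0 : ℝ) 1 := fun _ => ⟨zero_le_one, le_rfl⟩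
  have hqi : Integrable q M.Pmix := by
    simpa using M.integrable_Pmix_mul hq measurable_const hq01 h1
  have hWi : Integrable M.Lfdr M.Pmix := by
    simpa using M.integrable_Pmix_mul M.measurable_Lfdr measurable_const M.Lfdr_mem_Icc h1
  have hqW := M.integrable_Pmix_mul hq M.measurable_Lfdr hq01 M.Lfdr_mem_Icc
  have : ∀ x, (1 - q x) * (1 - M.Lfdr x) = 1 - q x - M.Lfdr x + q x * M.Lfdr x :=
    fun x => by ring
  simp only [this]
  exact integral_const_sub_sub_add 1 hqi hWi hqW

theorem exists_rejection_probability_of_prob {n : ℕ} (hn : n ≠ 0) {α β : ℝ} (hα : 0 ≤ α)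
    (hβ : 0 ≤ β) {κ : (Fin n → 𝒳) → Measure (Fin n → Bool)} (h : IsRule κ) :
    ∃ q : 𝒳 → ℝ, Measurable q ∧ (∀ x, q x ∈ Set.Icc (0 : ℝ) 1) ∧
      ∫ x, q x * M.Lfdr x ∂M.Pmix ≤
        α * ∫ x, q x ∂M.Pmix + (1 - M.prob n κ fun θ => {d | FDP θ d ≤ α}) ∧
      ∫ x, (1 - q x) * (1 - M.Lfdr x) ∂M.Pmix ≤
        β * (1 - ∫ x, q x ∂M.Pmix) + (1 - M.prob n κ fun θ => {d | FNP θ d ≤ β}) := by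
  obtain ⟨q, hq, hq01, hrej, hfd, hnull⟩ := M.exists_average_rejection_probability hn h
  have hn' : (0 : ℝ) < n := by exact_mod_cast Nat.pos_of_ne_zero hn
  have hAle : ∀ d : Fin n → Bool, nAcc d ≤ n := fun d => by
    rw [nAcc_eq]; linarith [nRej_nonneg d]
  have hRle : ∀ d : Fin n → Bool, nRej d ≤ n := fun d => by
    linarith [nAcc_eq d, nAcc_nonneg d]
  have iR := M.integrable_ruleLaw h fun _ d => nRej d
  have iF := M.integrable_ruleLaw h nFD
  have iN := M.integrable_ruleLaw h fun θ _ => ∑ i, if θ i then (0 : ℝ) else 1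
  refine ⟨q, hq, hq01, ?_, ?_⟩
  · have key := M.integral_ruleLaw_le_of_event h (fun θ d => nFD θ d - α * nRej d)
      (fun θ => {d | FDP θ d ≤ α})
      (fun θ d => by
        nlinarith [mul_nonneg hα (nRej_nonneg d), nFD_le_nRej θ d, hRle d])
      (fun θ d hd => sub_nonpos.2 (nFD_le_of_FDP_le hd))
    rw [integral_sub iF (iR.const_mul α), integral_const_mul, hfd, hrej] at key
    refine le_of_mul_le_mul_left ?_ hn'
    linarith
  · have key := M.integral_ruleLaw_le_of_event h (fun θ d => nFN θ d - β * nAcc d)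
      (fun θ => {d | FNP θ d ≤ β})
      (fun θ d => by
        nlinarith [mul_nonneg hβ (nAcc_nonneg d), nFN_le_nAcc θ d, hAle d])
      (fun θ d hd => sub_nonpos.2 (nFN_le_of_FNP_le hd))
    rw [integral_sub (M.integrable_ruleLaw h nFN)
      ((M.integrable_ruleLaw h fun _ d => nAcc d).const_mul β), integral_const_mul] at key
    simp only [nFN_eq, nAcc_eq] at key
    rw [integral_const_sub_sub_add _ iR iN iF, integral_sub (integrable_const _) iR,
      hfd, hrej, hnull] at key
    rw [M.integral_one_sub_mul_one_sub_Lfdr hq hq01]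
    simp only [integral_const, probReal_univ, one_smul] at key
    refine le_of_mul_le_mul_left ?_ hn'
    linarith

/-- The rule for a single hypothesis that rejects with probability `q x` at the observation `x`. -/
noncomputable def singleRule (q : 𝒳 → ℝ) (x : Fin 1 → 𝒳) : Measure (Fin 1 → Bool) :=
  ENNReal.ofReal (q (x 0)) • Measure.dirac (fun _ => true) +
    ENNReal.ofReal (1 - q (x 0)) • Measure.dirac (fun _ => false)

theorem isRule_singleRule {q : 𝒳 → ℝ} (hq : Measurable q)
    (hq01 : ∀ x, q x ∈ Set.Icc (0 : ℝ) 1) : IsRule (singleRule q) := by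
  have hq0 : Measurable fun x : Fin 1 → 𝒳 => q (x 0) := hq.comp (measurable_pi_apply 0)
  refine ⟨Measure.measurable_of_measurable_coe _ fun s _ => ?_, fun x => ⟨?_⟩⟩
  · simp only [singleRule, Measure.add_apply, Measure.smul_apply, smul_eq_mul]
    exact (hq0.ennreal_ofReal.mul_const _).add ((hq0.const_sub 1).ennreal_ofReal.mul_const _)
  · simp only [singleRule, Measure.add_apply, Measure.smul_apply, smul_eq_mul, measure_univ,
      mul_one]
    rw [← ENNReal.ofReal_add (hq01 _).1 (sub_nonneg.2 (hq01 _).2)]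
    simp

theorem integral_singleRule {S : Type*} {q : S → ℝ} (hq01 : ∀ x, q x ∈ Set.Icc (0 : ℝ) 1)
    (x : Fin 1 → S) (F : (Fin 1 → Bool) → ℝ) :
    ∫ d, F d ∂(singleRule q x) =
      q (x 0) * F (fun _ => true) + (1 - q (x 0)) * F (fun _ => false) := by
  rw [singleRule, integral_add_measure (Integrable.of_finite.smul_measure ENNReal.ofReal_ne_top)
      (Integrable.of_finite.smul_measure ENNReal.ofReal_ne_top), integral_smul_measure,
    integral_smul_measure, integral_dirac, integral_dirac, ENNReal.toReal_ofReal (hq01 _).1,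
    ENNReal.toReal_ofReal (sub_nonneg.2 (hq01 _).2)]
  rfl

theorem integral_jointN_obs {n : ℕ} (i : Fin n) {g : 𝒳 → ℝ} (hg : Measurable g) :
    ∫ ω, g (ω i).2 ∂(M.jointN n) = ∫ x, g x ∂M.Pmix := by
  have h2 : (M.jointN n).map (fun ω => ω i) = M.joint :=
    (measurePreserving_eval (fun _ : Fin n => M.joint) i).map_eq
  rw [← joint_map_snd, ← h2, Measure.map_map measurable_snd (measurable_pi_apply i),
    integral_map (measurable_snd.comp (measurable_pi_apply i)).aemeasurable
      hg.aestronglyMeasurable]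
  rfl

theorem measurable_null_indicator {n : ℕ} (i : Fin n) :
    Measurable fun ω : Fin n → Bool × 𝒳 => (if (ω i).1 then (0 : ℝ) else 1) :=
  (Measurable.of_discrete (f := fun b : Bool => if b then (0 : ℝ) else 1)).comp
    (measurable_fst.comp (measurable_pi_apply i))

theorem integral_jointN_mul_null {n : ℕ} (i : Fin n) {g : 𝒳 → ℝ} (hg : Measurable g)
    (hg0 : ∀ x, 0 ≤ g x) :
    ∫ ω, g (ω i).2 * (if (ω i).1 then 0 else 1) ∂(M.jointN n) =
      ∫ x, g x * M.Lfdr x ∂M.Pmix := by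
  have hgi : Measurable fun ω : Fin n → Bool × 𝒳 => g (ω i).2 :=
    hg.comp (measurable_snd.comp (measurable_pi_apply i))
  have hWi : Measurable fun ω : Fin n → Bool × 𝒳 => M.Lfdr (ω i).2 :=
    M.measurable_Lfdr.comp (measurable_snd.comp (measurable_pi_apply i))
  have hgW : Measurable fun x => g x * M.Lfdr x := hg.mul M.measurable_Lfdr
  rw [← M.integral_jointN_obs i hgW,
    integral_eq_lintegral_of_nonneg_ae
      (ae_of_all _ fun ω => mul_nonneg (hg0 _) (by split_ifs <;> norm_num))
      (hgi.mul (measurable_null_indicator i)).aestronglyMeasurable,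
    integral_eq_lintegral_of_nonneg_ae
      (ae_of_all _ fun ω => mul_nonneg (hg0 _) (M.Lfdr_mem_Icc _).1)
      (hgi.mul hWi).aestronglyMeasurable]
  have := M.lintegral_jointN_null i (p := fun x => ENNReal.ofReal (g (x i)))
    (hg.comp (measurable_pi_apply i)).ennreal_ofReal
  simp only [ENNReal.ofReal_mul (hg0 _)]
  rw [← this]
  congr 1
  refine lintegral_congr fun ω => ?_
  split_ifs <;> simp

theorem mFDR_singleRule {q : 𝒳 → ℝ} (hq : Measurable q)
    (hq01 : ∀ x, q x ∈ Set.Icc (0 : ℝ) 1) :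
    M.mFDR 1 (singleRule q) = (∫ x, q x * M.Lfdr x ∂M.Pmix) / ∫ x, q x ∂M.Pmix := by
  rw [mFDR, ← M.integral_jointN_mul_null (0 : Fin 1) hq fun x => (hq01 x).1,
    ← M.integral_jointN_obs (0 : Fin 1) hq]
  simp [integral_singleRule hq01, nFD, nRej]

theorem mFNR_singleRule {q : 𝒳 → ℝ} (hq : Measurable q)
    (hq01 : ∀ x, q x ∈ Set.Icc (0 : ℝ) 1) :
    M.mFNR 1 (singleRule q) =
      (∫ x, (1 - q x) * (1 - M.Lfdr x) ∂M.Pmix) / ∫ x, (1 - q x) ∂M.Pmix := by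
  have hq0 : Measurable fun ω : Fin 1 → Bool × 𝒳 => q (ω 0).2 :=
    hq.comp (measurable_snd.comp (measurable_pi_apply 0))
  have hb0 : ∀ b : Bool, ‖if b then (0 : ℝ) else 1‖ ≤ 1 := fun b => by cases b <;> simp
  have iq : Integrable (fun ω : Fin 1 → Bool × 𝒳 => q (ω 0).2) (M.jointN 1) :=
    .of_bound hq0.aestronglyMeasurable 1 (ae_of_all _ fun ω => by
      rw [Real.norm_of_nonneg (hq01 _).1]; exact (hq01 _).2)
  have iθ : Integrable (fun ω : Fin 1 → Bool × 𝒳 => if (ω 0).1 then (0 : ℝ) else 1)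
      (M.jointN 1) :=
    .of_bound (measurable_null_indicator 0).aestronglyMeasurable 1 (ae_of_all _ fun ω => hb0 _)
  have iqθ : Integrable (fun ω : Fin 1 → Bool × 𝒳 =>
      q (ω 0).2 * if (ω 0).1 then (0 : ℝ) else 1) (M.jointN 1) :=
    .of_bound (hq0.mul (measurable_null_indicator 0)).aestronglyMeasurable 1
      (ae_of_all _ fun ω => by
        rw [norm_mul, Real.norm_of_nonneg (hq01 _).1]
        exact mul_le_one₀ (hq01 _).2 (norm_nonneg _) (hb0 _))
  have hθ := M.integral_jointN_mul_null (0 : Fin 1) (measurable_const (a := (1 : ℝ)))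
    fun _ => zero_le_one
  simp only [one_mul] at hθ
  rw [M.integral_one_sub_mul_one_sub_Lfdr hq hq01, ← M.integral_jointN_obs (0 : Fin 1) hq, ← hθ,
    ← M.integral_jointN_mul_null (0 : Fin 1) hq fun x => (hq01 x).1,
    ← integral_const_sub_sub_add 1 iq iθ iqθ,
    ← M.integral_jointN_obs (0 : Fin 1) (hq.const_sub 1), mFNR]
  simp only [integral_singleRule hq01]
  congr 1
  · refine integral_congr_ae (ae_of_all _ fun ω => ?_)
    simp only [nFN, Fin.sum_univ_one]
    by_cases hb : (ω 0).1 = true <;> simp [hb]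
  · simp [nAcc]

theorem mFNR_nonneg (n : ℕ) (κ : (Fin n → 𝒳) → Measure (Fin n → Bool)) : 0 ≤ M.mFNR n κ :=
  div_nonneg (integral_nonneg fun _ => integral_nonneg fun _ => nFN_nonneg _ _)
    (integral_nonneg fun _ => integral_nonneg fun _ => nAcc_nonneg _)

theorem mFNRstar_le_of_rejection_probability {α β : ℝ} (hα : 0 ≤ α) (hβ : 0 ≤ β) {q : 𝒳 → ℝ}
    (hq : Measurable q) (hq01 : ∀ x, q x ∈ Set.Icc (0 : ℝ) 1)
    (hFD : ∫ x, q x * M.Lfdr x ∂M.Pmix ≤ α * ∫ x, q x ∂M.Pmix)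
    (hFN : ∫ x, (1 - q x) * (1 - M.Lfdr x) ∂M.Pmix ≤ β * ∫ x, (1 - q x) ∂M.Pmix) :
    M.mFNRstar α ≤ β := by
  calc M.mFNRstar α ≤ M.mFNR 1 (singleRule q) := by
        refine csInf_le ⟨0, ?_⟩ ⟨singleRule q, isRule_singleRule hq hq01, ?_, rfl⟩
        · rintro r ⟨κ, -, -, rfl⟩
          exact M.mFNR_nonneg 1 κ
        · rw [mFDR_singleRule _ hq hq01]
          exact div_le_of_le_mul₀ (integral_nonneg fun x => (hq01 x).1) hα hFD
    _ ≤ β := by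
        rw [mFNR_singleRule _ hq hq01]
        exact div_le_of_le_mul₀ (integral_nonneg fun x => sub_nonneg.2 (hq01 x).2) hβ hFN

end Model

/-- **Optimal FDP control with high probability** (Theorem 2, converse part). If a sequence of
decision rules has `P(FDP ≤ α) → 1` and `P(FNP ≤ β) → 1`, then `β ≥ mFNR*(α)`. -/
theorem mFNRstar_le_of_high_prob_control {𝒳 : Type*} [MeasurableSpace 𝒳] (M : Model 𝒳)
    (α β : ℝ) (hα : α ∈ Set.Icc (0 : ℝ) 1) (hβ : β ∈ Set.Icc (0 : ℝ) 1)
    (κ : ∀ n : ℕ, (Fin n → 𝒳) → Measure (Fin n → Bool))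
    (hrule : ∀ n, IsRule (κ n))
    (hFDP : Filter.Tendsto
      (fun n => M.prob n (κ n) fun θ => {d | FDP θ d ≤ α}) Filter.atTop (nhds 1))
    (hFNP : Filter.Tendsto
      (fun n => M.prob n (κ n) fun θ => {d | FNP θ d ≤ β}) Filter.atTop (nhds 1)) :
    M.mFNRstar α ≤ β := by
  have hW := M.measurable_Lfdr
  have hall : ∀ n : ℕ, ∃ q : 𝒳 → ℝ, Measurable q ∧ (∀ x, q x ∈ Set.Icc (0 : ℝ) 1) ∧
      (n ≠ 0 → ∫ x, q x * M.Lfdr x ∂M.Pmix ≤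
        α * ∫ x, q x ∂M.Pmix + (1 - M.prob n (κ n) fun θ => {d | FDP θ d ≤ α})) ∧
      (n ≠ 0 → ∫ x, (1 - q x) * (1 - M.Lfdr x) ∂M.Pmix ≤
        β * (1 - ∫ x, q x ∂M.Pmix) + (1 - M.prob n (κ n) fun θ => {d | FNP θ d ≤ β})) := by
    intro n
    rcases eq_or_ne n 0 with hn | hn
    · exact ⟨0, measurable_zero, fun _ => ⟨le_rfl, zero_le_one⟩, fun h => absurd hn h,
        fun h => absurd hn h⟩
    · obtain ⟨q, hq, hq01, h1, h2⟩ :=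
        M.exists_rejection_probability_of_prob hn hα.1 hβ.1 (hrule n)
      exact ⟨q, hq, hq01, fun _ => h1, fun _ => h2⟩
  choose q hq hq01 hFD hFN using hall
  obtain ⟨q', hq', hq'01, hlim⟩ := exists_weak_limit (μ := M.Pmix) hq hq01
  have hle : (hyperfilter ℕ : Filter ℕ) ≤ atTop := Nat.hyperfilter_le_atTop
  have hlim1 : Tendsto (fun n => ∫ x, q n x ∂M.Pmix) (hyperfilter ℕ)
      (nhds (∫ x, q' x ∂M.Pmix)) := by
    simpa using hlim (fun _ => 1) (memLp_const 1)
  have hlimW : Tendsto (fun n => ∫ x, q n x * M.Lfdr x ∂M.Pmix) (hyperfilter ℕ)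
      (nhds (∫ x, q' x * M.Lfdr x ∂M.Pmix)) :=
    hlim M.Lfdr <| MemLp.of_bound hW.aestronglyMeasurable 1 <| ae_of_all _ fun x => by
      rw [Real.norm_of_nonneg (M.Lfdr_mem_Icc x).1]
      exact (M.Lfdr_mem_Icc x).2
  have hne : ∀ᶠ n : ℕ in hyperfilter ℕ, n ≠ 0 := hle (eventually_ne_atTop 0)
  refine M.mFNRstar_le_of_rejection_probability hα.1 hβ.1 hq' hq'01 ?_ ?_
  · have hr := (hlim1.const_mul α).add ((hFDP.mono_left hle).const_sub 1)
    rw [sub_self, add_zero] at hr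
    exact le_of_tendsto_of_tendsto hlimW hr (hne.mono fun n hn => hFD n hn)
  · have hr := ((hlim1.const_sub 1).const_mul β).add ((hFNP.mono_left hle).const_sub 1)
    rw [sub_self, add_zero] at hr
    have hqi : Integrable q' M.Pmix := by
      simpa using M.integrable_Pmix_mul (k := fun _ => 1) hq' measurable_const hq'01
        fun _ => ⟨zero_le_one, le_rfl⟩
    rw [integral_sub (integrable_const _) hqi, integral_const, probReal_univ, one_smul,
      M.integral_one_sub_mul_one_sub_Lfdr hq' hq'01]
    refine le_of_tendsto_of_tendsto
      (((hlim1.const_sub 1).sub_const (∫ x, M.Lfdr x ∂M.Pmix)).add hlimW) hr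
      (hne.mono fun n hn => ?_)
    have := hFN n hn
    rwa [M.integral_one_sub_mul_one_sub_Lfdr (hq n) (hq01 n)] at this

end TwoGroup
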